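/- arXiv:2312.05706 — 4 statements merged into one kernel-verified Lean document; each statement's English description precedes it below -/
import Mathlib

section
/- Let b be a positive integer, β a real number, and let r ∈ [0,1) satisfy r·2^b ∈ ℤ, with binary digits v_1, …, v_b ∈ {0,1} such that r = ∑_{i=1}^{b} v_i·2^{-i}. Let θ_i = e^{β/2^i}/(1 + e^{β/2^i}) for each i. Then (∫_r^{r+2^{-b}} e^{βy} dy) / (∫_0^1 e^{βy} dy) = ∏_{i=1}^{b} θ_i^{v_i}·(1 − θ_i)^{1 − v_i}. -/
open Real Finset intervalIntegral

/-- Translating the interval by `r` scales the exponential integral by `exp (β * r)`. -/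
theorem integral_exp_mul_add (β r h : ℝ) :
    ∫ y in r..(r + h), Real.exp (β * y) =
      Real.exp (β * r) * ∫ y in (0:ℝ)..h, Real.exp (β * y) := by
  have key := intervalIntegral.integral_comp_add_left
    (a := 0) (b := h) (fun y => Real.exp (β * y)) r
  rw [add_zero] at key
  rw [← key, ← intervalIntegral.integral_const_mul]
  simp only [mul_add, Real.exp_add]

theorem integral_exp_mul_two_mul (β h : ℝ) :
    ∫ y in (0:ℝ)..(h + h), Real.exp (β * y) =
      (1 + Real.exp (β * h)) * ∫ y in (0:ℝ)..h, Real.exp (β * y) := by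
  have hint : ∀ a c : ℝ, IntervalIntegrable (fun y => Real.exp (β * y)) MeasureTheory.volume a c :=
    fun a c => Continuous.intervalIntegrable (by fun_prop) a c
  rw [← intervalIntegral.integral_add_adjacent_intervals (hint 0 h) (hint h (h + h)),
    integral_exp_mul_add]
  ring

/-- Halving the unit interval `b` times. -/
theorem integral_exp_mul_zero_one (β : ℝ) (b : ℕ) :
    ∫ y in (0:ℝ)..1, Real.exp (β * y) =
      (∏ i ∈ Finset.Icc 1 b, (1 + Real.exp (β / 2 ^ i))) *
        ∫ y in (0:ℝ)..(1 / 2 ^ b), Real.exp (β * y) := by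
  induction b with
  | zero => simp
  | succ n ih =>
    have hsplit : (1 : ℝ) / 2 ^ n = 1 / 2 ^ (n + 1) + 1 / 2 ^ (n + 1) := by
      field_simp
      ring
    rw [ih, Finset.prod_Icc_succ_top (by omega), hsplit, integral_exp_mul_two_mul,
      mul_one_div, mul_assoc]

/-- A logistic Bernoulli weight in exponential form. -/
theorem logistic_pow_mul_one_sub_pow (t : ℝ) {v : ℕ} (hv : v = 0 ∨ v = 1) :
    (Real.exp t / (1 + Real.exp t)) ^ v * (1 - Real.exp t / (1 + Real.exp t)) ^ (1 - v) =
      Real.exp (t * v) / (1 + Real.exp t) := by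
  have hpos : 1 + Real.exp t ≠ 0 := by positivity
  rcases hv with rfl | rfl
  · simp
    field_simp
    ring
  · simp

/-- Cell masses of the discretized exponential density factor as a product of
per-bit Bernoulli probabilities: if r ∈ [0,1) is a b-bit grid point with binary
digits v_1, …, v_b and θ_i = e^{β/2^i}/(1 + e^{β/2^i}), then
(∫_r^{r+2^{-b}} e^{βy} dy)/(∫_0^1 e^{βy} dy) = ∏_{i=1}^b θ_i^{v_i}(1 − θ_i)^{1−v_i}. -/
theorem exponential_cell_mass_eq_prod_flips
    (b : ℕ) (hb : 0 < b) (β : ℝ) (r : ℝ) (hr : r ∈ Set.Ico (0:ℝ) 1)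
    (hgrid : ∃ z : ℤ, r * 2 ^ b = (z : ℝ))
    (v : ℕ → ℕ) (hv : ∀ i, v i = 0 ∨ v i = 1)
    (hdigits : r = ∑ i ∈ Finset.Icc 1 b, (v i : ℝ) / 2 ^ i)
    (θ : ℕ → ℝ) (hθ : ∀ i, θ i = Real.exp (β / 2 ^ i) / (1 + Real.exp (β / 2 ^ i))) :
    (∫ y in r..(r + 1 / 2 ^ b), Real.exp (β * y)) /
        (∫ y in (0:ℝ)..1, Real.exp (β * y)) =
      ∏ i ∈ Finset.Icc 1 b, θ i ^ (v i) * (1 - θ i) ^ (1 - v i) := by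
  have hfactor : ∀ i ∈ Finset.Icc 1 b, θ i ^ (v i) * (1 - θ i) ^ (1 - v i) =
      Real.exp (β * ((v i : ℝ) / 2 ^ i)) / (1 + Real.exp (β / 2 ^ i)) := by
    intro i _
    rw [hθ, logistic_pow_mul_one_sub_pow _ (hv i), div_mul_eq_mul_div, mul_div_assoc]
  have hcell : (∫ y in (0:ℝ)..(1 / 2 ^ b), Real.exp (β * y)) ≠ 0 :=
    (intervalIntegral.intervalIntegral_pos_of_pos
      (Continuous.intervalIntegrable (by fun_prop) _ _)
      (fun _ => Real.exp_pos _) (by positivity)).ne'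
  rw [Finset.prod_congr rfl hfactor, Finset.prod_div_distrib, ← Real.exp_sum,
    ← Finset.mul_sum, ← hdigits, integral_exp_mul_add, integral_exp_mul_zero_one β b,
    mul_div_mul_right _ _ hcell]
end

section
/- Let b be a positive integer, h = 2^{-b}, and β a real number. Let X and Y be independent random variables with X having density e^{βx}/∫_0^1 e^{βy}dy on [0,1) and Y uniform on [0,1), and write X_b = h·⌊X/h⌋, Y_b = h·⌊Y/h⌋. Then for every grid point r ∈ [0,1) with r·2^b ∈ ℤ, P(X_b = r | Y_b = X_b ∧ Y < X) = (∫_r^{r+h} e^{βx} dx) / (∫_0^1 e^{βx} dx). That is, the correction term for the discretized inequality observation is again the b-bit discretization of the exponential density with rate β. -/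
open MeasureTheory ProbabilityTheory Real intervalIntegral

/-- Integrating over `[s, s + h)` against an exponential weight is, up to the factor `e^{βs}`,
integrating over `[0, h)`. -/
lemma setLIntegral_Ico_exp_mul_comp_sub (β Z s h : ℝ) (F : ℝ → ENNReal) :
    ∫⁻ x in Set.Ico s (s + h), ENNReal.ofReal (Real.exp (β * x) / Z) * F (x - s) =
      ENNReal.ofReal (Real.exp (β * s)) *
        ∫⁻ u in Set.Ico 0 h, ENNReal.ofReal (Real.exp (β * u) / Z) * F u := by
  rw [← lintegral_indicator measurableSet_Ico, ← lintegral_indicator measurableSet_Ico,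
    ← lintegral_const_mul' _ _ ENNReal.ofReal_ne_top,
    ← lintegral_sub_right_eq_self (μ := volume) (fun u => _ * (Set.Ico 0 h).indicator _ u) s]
  refine lintegral_congr fun x => ?_
  by_cases hx : x ∈ Set.Ico s (s + h)
  · have hx' : x - s ∈ Set.Ico 0 h := ⟨by linarith [hx.1], by linarith [hx.2]⟩
    rw [Set.indicator_of_mem hx, Set.indicator_of_mem hx', ← mul_assoc,
      ← ENNReal.ofReal_mul (Real.exp_pos _).le, ← mul_div_assoc, ← Real.exp_add]
    ring_nf
  · have hx' : x - s ∉ Set.Ico 0 h := fun hx' =>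
      hx ⟨by linarith [hx'.1], by linarith [hx'.2]⟩
    rw [Set.indicator_of_notMem hx, Set.indicator_of_notMem hx', mul_zero]

/-- If a random variable `N` almost surely lies in the finite set `s`, the mass of an event is the
sum of the masses of its intersections with the events `N = k`. -/
lemma measure_eq_sum_inter_preimage_singleton {Ω α : Type*} [MeasurableSpace Ω]
    {μ : Measure Ω} {E : Set Ω} (s : Finset α) {N : Ω → α}
    (hN : ∀ k, MeasurableSet (N ⁻¹' {k})) (hs : ∀ᵐ ω ∂μ, N ω ∈ s) :
    μ E = ∑ k ∈ s, μ (E ∩ N ⁻¹' {k}) := by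
  have h1 := sum_measure_preimage_singleton (μ := μ.restrict E) s (f := N) (fun k _ => hN k)
  simp only [Measure.restrict_apply (hN _)] at h1
  simp only [Set.inter_comm E]
  rw [h1, ← Measure.restrict_apply_univ E]
  refine measure_congr ?_
  filter_upwards [ae_restrict_of_ae hs] with ω hω
  exact propext ⟨fun _ => hω, fun _ => trivial⟩

lemma floor_div_eq_iff_mem_Ico {h x : ℝ} (hpos : 0 < h) (k : ℤ) :
    ⌊x / h⌋ = k ↔ x ∈ Set.Ico (k * h) (k * h + h) := by
  rw [Int.floor_eq_iff, le_div_iff₀ hpos, div_lt_iff₀ hpos, add_mul, one_mul, Set.mem_Ico]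

/-- The mass of `{X ∈ [s, s + h), s ≤ Y < X}` for `X` with density `f` on `[0, 1)` and `Y`
independent and uniform on `[0, 1)`. -/
lemma measure_prodMk_mem_triangle {f : ℝ → ENNReal} (hf : Measurable f) {s h : ℝ} (hs : 0 ≤ s)
    (hsh : s + h ≤ 1)
    [SFinite ((volume.restrict (Set.Ico (0:ℝ) 1)).withDensity f)] :
    (((volume.restrict (Set.Ico (0:ℝ) 1)).withDensity f).prod
      (volume.restrict (Set.Ico (0:ℝ) 1)))
        {p : ℝ × ℝ | p.1 ∈ Set.Ico s (s + h) ∧ s ≤ p.2 ∧ p.2 < p.1} =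
      ∫⁻ x in Set.Ico s (s + h), f x * ENNReal.ofReal (x - s) := by
  have hmeas : MeasurableSet {p : ℝ × ℝ | p.1 ∈ Set.Ico s (s + h) ∧ s ≤ p.2 ∧ p.2 < p.1} :=
    (measurable_fst measurableSet_Ico).inter
      ((measurableSet_le measurable_const measurable_snd).inter
        (measurableSet_lt measurable_snd measurable_fst))
  have hsub : Set.Ico s (s + h) ⊆ Set.Ico 0 1 := Set.Ico_subset_Ico hs hsh
  have hsec : ∀ x, (volume.restrict (Set.Ico (0:ℝ) 1))
      (Prod.mk x ⁻¹' {p : ℝ × ℝ | p.1 ∈ Set.Ico s (s + h) ∧ s ≤ p.2 ∧ p.2 < p.1}) =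
      (Set.Ico s (s + h)).indicator (fun x => ENNReal.ofReal (x - s)) x := by
    intro x
    rw [Measure.restrict_apply (measurable_prodMk_left hmeas)]
    by_cases hx : x ∈ Set.Ico s (s + h)
    · rw [Set.indicator_of_mem hx, ← Real.volume_Ico]
      congr 1
      ext y
      simp only [Set.mem_inter_iff, Set.mem_preimage, Set.mem_ofPred_eq, Set.mem_Ico] at hx ⊢
      constructor
      · rintro ⟨⟨-, h1, h2⟩, -⟩
        exact ⟨h1, h2⟩
      · rintro ⟨h1, h2⟩
        exact ⟨⟨hx, h1, h2⟩, by linarith, by linarith [hx.2]⟩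
    · rw [Set.indicator_of_notMem hx]
      convert measure_empty (μ := (volume : Measure ℝ))
      ext y
      simp only [Set.mem_inter_iff, Set.mem_preimage, Set.mem_ofPred_eq, Set.mem_empty_iff_false,
        iff_false]
      exact fun h1 => hx h1.1.1
  rw [Measure.prod_apply hmeas, lintegral_congr hsec, lintegral_indicator measurableSet_Ico,
    restrict_withDensity measurableSet_Ico, Measure.restrict_restrict measurableSet_Ico,
    Set.inter_eq_left.2 hsub,
    lintegral_withDensity_eq_lintegral_mul _ hf (by fun_prop)]
  rfl

/-- The correction term is again a discretized exponential: with X exponential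
(rate β) on [0,1), Y independent uniform on [0,1), and X_b = h⌊X/h⌋, Y_b = h⌊Y/h⌋
for h = 2^{-b}, for every b-bit grid point r,
P(X_b = r | Y_b = X_b ∧ Y < X) = (∫_r^{r+h} e^{βx} dx)/(∫_0^1 e^{βx} dx). -/
theorem correction_term_is_discretized_exponential
    {Ω : Type*} [MeasurableSpace Ω] (μ : Measure Ω) [IsProbabilityMeasure μ]
    (b : ℕ) (hb : 0 < b) (h : ℝ) (hh : h = 1 / 2 ^ b) (β : ℝ)
    (X Y : Ω → ℝ) (hX : Measurable X) (hY : Measurable Y)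
    (hindep : IndepFun X Y μ)
    (hlawX : Measure.map X μ =
      (volume.restrict (Set.Ico (0:ℝ) 1)).withDensity
        (fun x => ENNReal.ofReal (Real.exp (β * x) / ∫ y in (0:ℝ)..1, Real.exp (β * y))))
    (hlawY : Measure.map Y μ = volume.restrict (Set.Ico (0:ℝ) 1))
    (Xb Yb : Ω → ℝ)
    (hXb : ∀ ω, Xb ω = h * (⌊X ω / h⌋ : ℝ)) (hYb : ∀ ω, Yb ω = h * (⌊Y ω / h⌋ : ℝ))
    (r : ℝ) (hr : r ∈ Set.Ico (0:ℝ) 1) (hgrid : ∃ z : ℤ, r * 2 ^ b = (z : ℝ)) :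
    μ[|{ω | Yb ω = Xb ω} ∩ {ω | Y ω < X ω}] {ω | Xb ω = r} =
      ENNReal.ofReal ((∫ x in r..(r + h), Real.exp (β * x)) /
        ∫ x in (0:ℝ)..1, Real.exp (β * x)) := by
  have hpow : (0:ℝ) < 2 ^ b := by positivity
  have hpos : 0 < h := by rw [hh]; positivity
  have hmul : (2:ℝ) ^ b * h = 1 := by rw [hh]; field_simp
  set Z : ℝ := ∫ y in (0:ℝ)..1, Real.exp (β * y) with hZ
  have hZpos : 0 < Z :=
    intervalIntegral_pos_of_pos ((by fun_prop : Continuous _).intervalIntegrable _ _)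
      (fun _ => Real.exp_pos _) one_pos
  have hfmeas : Measurable fun x : ℝ => ENNReal.ofReal (Real.exp (β * x) / Z) := by fun_prop
  set N : Ω → ℤ := fun ω => ⌊X ω / h⌋ with hNdef
  have hN : Measurable N := (hX.div_const h).floor
  set E : Set Ω := {ω | Yb ω = Xb ω} ∩ {ω | Y ω < X ω} with hE
  have hXbm : Measurable Xb := by
    rw [funext hXb]
    exact (measurable_from_top.comp hN).const_mul h
  have hYbm : Measurable Yb := by
    rw [funext hYb]
    exact (measurable_from_top.comp (hY.div_const h).floor).const_mul h
  have hEm : MeasurableSet E := (measurableSet_eq_fun hYbm hXbm).inter (measurableSet_lt hY hX)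
  have hcell : ∀ k ∈ Finset.Ico (0:ℤ) (2 ^ b), (0:ℝ) ≤ k * h ∧ k * h + h ≤ 1 := by
    intro k hk
    obtain ⟨hk0, hk1⟩ := Finset.mem_Ico.1 hk
    have hk0' : (0:ℝ) ≤ k := by exact_mod_cast hk0
    have hk1' : (k:ℝ) + 1 ≤ 2 ^ b := by exact_mod_cast hk1
    exact ⟨by positivity, by nlinarith⟩
  have hNs : ∀ᵐ ω ∂μ, N ω ∈ Finset.Ico (0:ℤ) (2 ^ b) := by
    have h1 : ∀ᵐ x ∂(Measure.map X μ), x ∈ Set.Ico (0:ℝ) 1 := by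
      rw [hlawX]
      exact (withDensity_absolutelyContinuous _ _).ae_le (ae_restrict_mem measurableSet_Ico)
    filter_upwards [ae_of_ae_map hX.aemeasurable h1] with ω hω
    rw [Finset.mem_Ico]
    refine ⟨Int.floor_nonneg.2 (div_nonneg hω.1 hpos.le), Int.floor_lt.2 ?_⟩
    rw [div_lt_iff₀ hpos]
    push_cast
    rw [hmul]
    exact hω.2
  have hXcell : ∀ k ∈ Finset.Ico (0:ℤ) (2 ^ b), μ (N ⁻¹' {k}) =
      ∫⁻ x in Set.Ico (k * h) (k * h + h), ENNReal.ofReal (Real.exp (β * x) / Z) := by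
    intro k hk
    have h1 : N ⁻¹' {k} = X ⁻¹' Set.Ico (k * h) (k * h + h) :=
      Set.ext fun ω => floor_div_eq_iff_mem_Ico hpos k
    rw [h1, ← Measure.map_apply hX measurableSet_Ico, hlawX,
      withDensity_apply _ measurableSet_Ico, Measure.restrict_restrict measurableSet_Ico,
      Set.inter_eq_left.2 (Set.Ico_subset_Ico (hcell k hk).1 (hcell k hk).2)]
  have hEcell : ∀ k ∈ Finset.Ico (0:ℤ) (2 ^ b), μ (E ∩ N ⁻¹' {k}) =
      ∫⁻ x in Set.Ico (k * h) (k * h + h), ENNReal.ofReal (Real.exp (β * x) / Z) *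
        ENNReal.ofReal (x - k * h) := by
    intro k hk
    have h1 : E ∩ N ⁻¹' {k} = (fun ω => (X ω, Y ω)) ⁻¹'
        {p : ℝ × ℝ | p.1 ∈ Set.Ico (k * h) (k * h + h) ∧ k * h ≤ p.2 ∧ p.2 < p.1} := by
      ext ω
      simp only [hE, hNdef, Set.mem_inter_iff, Set.mem_preimage, Set.mem_singleton_iff,
        Set.mem_ofPred_eq, hXb, hYb, mul_right_inj' hpos.ne', Int.cast_inj]
      constructor
      · rintro ⟨⟨h2, h3⟩, h4⟩
        rw [h4, floor_div_eq_iff_mem_Ico hpos] at h2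
        exact ⟨(floor_div_eq_iff_mem_Ico hpos k).1 h4, h2.1, h3⟩
      · rintro ⟨h2, h3, h4⟩
        have h5 := (floor_div_eq_iff_mem_Ico hpos k).2 h2
        have h6 := (floor_div_eq_iff_mem_Ico hpos k).2 ⟨h3, h4.trans h2.2⟩
        exact ⟨⟨h6.trans h5.symm, h4⟩, h5⟩
    have hmeas : MeasurableSet
        {p : ℝ × ℝ | p.1 ∈ Set.Ico (k * h) (k * h + h) ∧ k * h ≤ p.2 ∧ p.2 < p.1} :=
      (measurable_fst measurableSet_Ico).inter
        ((measurableSet_le measurable_const measurable_snd).inter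
          (measurableSet_lt measurable_snd measurable_fst))
    rw [h1, ← Measure.map_apply (hX.prodMk hY) hmeas,
      (indepFun_iff_map_prod_eq_prod_map_map hX.aemeasurable hY.aemeasurable).1 hindep,
      hlawX, hlawY, measure_prodMk_mem_triangle hfmeas (hcell k hk).1 (hcell k hk).2]
  set a : ℤ → ENNReal := fun k => ENNReal.ofReal (Real.exp (β * (k * h))) with ha
  set C := ∫⁻ u in Set.Ico 0 h, ENNReal.ofReal (Real.exp (β * u) / Z) * ENNReal.ofReal u with hC
  set D := ∫⁻ u in Set.Ico 0 h, ENNReal.ofReal (Real.exp (β * u) / Z) with hD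
  have hXa : ∀ k ∈ Finset.Ico (0:ℤ) (2 ^ b), μ (N ⁻¹' {k}) = a k * D := by
    intro k hk
    rw [hXcell k hk]
    simpa using setLIntegral_Ico_exp_mul_comp_sub β Z (k * h) h (fun _ => 1)
  have hEa : ∀ k ∈ Finset.Ico (0:ℤ) (2 ^ b), μ (E ∩ N ⁻¹' {k}) = a k * C := by
    intro k hk
    rw [hEcell k hk]
    exact setLIntegral_Ico_exp_mul_comp_sub β Z (k * h) h ENNReal.ofReal
  have hNm : ∀ k, MeasurableSet (N ⁻¹' {k}) := fun k => hN (measurableSet_singleton k)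
  have hsumD : (∑ k ∈ Finset.Ico (0:ℤ) (2 ^ b), a k) * D = 1 := by
    rw [Finset.sum_mul, ← Finset.sum_congr rfl hXa, ← measure_univ (μ := μ),
      measure_eq_sum_inter_preimage_singleton _ hNm hNs]
    simp only [Set.univ_inter]
  have hsumC : μ E = (∑ k ∈ Finset.Ico (0:ℤ) (2 ^ b), a k) * C := by
    rw [Finset.sum_mul, ← Finset.sum_congr rfl hEa,
      measure_eq_sum_inter_preimage_singleton _ hNm hNs]
  have hC0 : C ≠ 0 := by
    rw [hC, ← pos_iff_ne_zero, setLIntegral_pos_iff (by fun_prop)]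
    refine lt_of_lt_of_le ?_ (measure_mono (s := Set.Ioo 0 h) fun u hu => ⟨?_, hu.1.le, hu.2⟩)
    · simpa using hpos
    · rw [Function.mem_support]
      exact mul_ne_zero (ENNReal.ofReal_pos.2 (by positivity)).ne' (ENNReal.ofReal_pos.2 hu.1).ne'
  have hE0 : μ E ≠ 0 := by
    rw [hsumC]
    refine mul_ne_zero (fun h0 => ?_) hC0
    rw [h0, zero_mul] at hsumD
    exact zero_ne_one hsumD
  obtain ⟨z, hz⟩ := hgrid
  have hrz : r = z * h := by rw [← hz, mul_assoc, hmul, mul_one]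
  have hzs : z ∈ Finset.Ico (0:ℤ) (2 ^ b) := by
    rw [Finset.mem_Ico]
    constructor
    · have : (0:ℝ) ≤ z := by rw [← hz]; exact mul_nonneg hr.1 hpow.le
      exact_mod_cast this
    · have : (z:ℝ) < 2 ^ b := by rw [← hz]; nlinarith [hr.2]
      exact_mod_cast this
  have hset : {ω | Xb ω = r} = N ⁻¹' {z} := by
    ext ω
    simp only [Set.mem_ofPred_eq, hXb, hrz, mul_comm (z:ℝ), mul_right_inj' hpos.ne', Int.cast_inj,
      Set.mem_preimage, Set.mem_singleton_iff, hNdef]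
  have hcond : μ[|E] {ω | Xb ω = r} = μ (N ⁻¹' {z}) := by
    have h1 : a z * C = μ E * (a z * D) := by
      rw [hsumC, ← one_mul (a z * C), ← hsumD]
      ring
    rw [cond_apply hEm, hset, hEa z hzs, hXa z hzs, h1, ← mul_assoc,
      ENNReal.inv_mul_cancel hE0 (measure_ne_top μ E), one_mul]
  rw [hcond, hXcell z hzs, ← hrz, ← intervalIntegral.integral_div,
    intervalIntegral.integral_of_le (by linarith), ← integral_Ico_eq_integral_Ioc,
    ofReal_integral_eq_lintegral_ofReal]
  · exact ((by fun_prop : Continuous fun x : ℝ => Real.exp (β * x) / Z).integrableOn_Icc).mono_set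
      Set.Ico_subset_Icc_self
  · exact Filter.Eventually.of_forall fun x => by positivity
end

section
/- Let b be a positive integer, h = 2^{-b}, and β a nonzero real number. Let X and Y be independent random variables with X having density e^{βx}/∫_0^1 e^{βy}dy on [0,1) and Y uniform on [0,1), and write X_b = h·⌊X/h⌋, Y_b = h·⌊Y/h⌋. Then P(Y_b = X_b | Y < X) = ((e^{βh}(βh − 1) + 1)(1 − e^{β})) / ((1 − e^{βh})(e^{β}(β − 1) + 1)). -/
open MeasureTheory ProbabilityTheory Real intervalIntegral

theorem integral_sub_mul_exp {β : ℝ} (hβ : β ≠ 0) (a u v : ℝ) :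
    ∫ x in u..v, Real.exp (β * x) * (x - a) =
      Real.exp (β * v) * ((v - a) / β - 1 / β ^ 2) -
        Real.exp (β * u) * ((u - a) / β - 1 / β ^ 2) := by
  apply intervalIntegral.integral_eq_sub_of_hasDerivAt
    (f := fun x => Real.exp (β * x) * ((x - a) / β - 1 / β ^ 2))
  · intro x _
    have h1 : HasDerivAt (fun x => Real.exp (β * x)) (Real.exp (β * x) * (β * 1)) x :=
      ((hasDerivAt_id x).const_mul β).exp
    have h2 : HasDerivAt (fun x => (x - a) / β - 1 / β ^ 2) (1 / β) x :=
      (((hasDerivAt_id x).sub_const a).div_const β).sub_const _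
    refine (h1.mul h2).congr_deriv ?_
    field_simp
    ring
  · exact Continuous.intervalIntegrable (by fun_prop) _ _

theorem exp_mul_sub_one_add_one_pos {t : ℝ} (ht : t ≠ 0) : 0 < Real.exp t * (t - 1) + 1 := by
  have h1 : -t + 1 < Real.exp (-t) := Real.add_one_lt_exp (neg_ne_zero.mpr ht)
  have h2 : Real.exp t * Real.exp (-t) = 1 := by rw [← Real.exp_add]; simp
  nlinarith [mul_lt_mul_of_pos_left h1 (Real.exp_pos t)]

theorem floor_div_eq_of_mem_Ioo {h : ℝ} (h0 : 0 < h) (k : ℕ) {x : ℝ}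
    (hx : x ∈ Set.Ioo (k * h) ((k + 1 : ℕ) * h)) : ⌊x / h⌋ = k := by
  rw [Int.floor_eq_iff, le_div_iff₀ h0, div_lt_iff₀ h0]
  push_cast at hx ⊢
  exact ⟨hx.1.le, hx.2⟩

theorem integral_exp_mul_sub_floor {β h : ℝ} (hβ : β ≠ 0) (h0 : 0 < h) (n : ℕ) :
    ∫ x in (0:ℝ)..n * h, Real.exp (β * x) * (x - h * ⌊x / h⌋) =
      (∑ k ∈ Finset.range n, Real.exp (β * h) ^ k) *
        ((Real.exp (β * h) * (β * h - 1) + 1) / β ^ 2) := by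
  have hle (k : ℕ) : (k : ℝ) * h ≤ (k + 1 : ℕ) * h := by
    push_cast; nlinarith
  have heq (k : ℕ) : Set.EqOn (fun x => Real.exp (β * x) * (x - k * h))
      (fun x => Real.exp (β * x) * (x - h * ⌊x / h⌋))
      (Set.Ioo (k * h) ((k + 1 : ℕ) * h)) := by
    intro x hx
    simp only [floor_div_eq_of_mem_Ioo h0 k hx, Int.cast_natCast, mul_comm h]
  have hint (k : ℕ) : IntervalIntegrable (fun x => Real.exp (β * x) * (x - h * ⌊x / h⌋))
      volume (k * h) ((k + 1 : ℕ) * h) := by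
    have hc : IntervalIntegrable (fun x => Real.exp (β * x) * (x - k * h))
      volume (k * h) ((k + 1 : ℕ) * h) := Continuous.intervalIntegrable (by fun_prop) _ _
    rw [intervalIntegrable_iff_integrableOn_Ioo_of_le (hle k)] at hc ⊢
    exact hc.congr_fun (heq k) measurableSet_Ioo
  have hsum := intervalIntegral.sum_integral_adjacent_intervals (n := n) (fun k _ => hint k)
  simp only [Nat.cast_zero, zero_mul] at hsum
  rw [← hsum, Finset.sum_mul]
  refine Finset.sum_congr rfl fun k _ => ?_
  have hk : ∫ x in k * h..(k + 1 : ℕ) * h, Real.exp (β * x) * (x - h * ⌊x / h⌋) =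
      ∫ x in k * h..(k + 1 : ℕ) * h, Real.exp (β * x) * (x - k * h) := by
    rw [intervalIntegral.integral_of_le (hle k), intervalIntegral.integral_of_le (hle k),
      integral_Ioc_eq_integral_Ioo, integral_Ioc_eq_integral_Ioo]
    exact setIntegral_congr_fun measurableSet_Ioo (heq k).symm
  have e1 : Real.exp (β * (k * h)) = Real.exp (β * h) ^ k := by
    rw [← Real.exp_nat_mul]; ring_nf
  have e2 : Real.exp (β * ((k + 1 : ℕ) * h)) = Real.exp (β * h) ^ k * Real.exp (β * h) := by
    rw [← pow_succ, ← Real.exp_nat_mul]; ring_nf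
  rw [hk, integral_sub_mul_exp hβ, e1, e2]
  push_cast
  field_simp
  ring

theorem measure_mem_Ico_of_indepFun {Ω : Type*} [MeasurableSpace Ω] {μ : Measure Ω}
    [IsProbabilityMeasure μ] {X Y : Ω → ℝ} (hX : Measurable X) (hY : Measurable Y)
    (hindep : IndepFun X Y μ) {f g : ℝ → ℝ} (hf : Measurable f) (hg : Measurable g)
    (hlawX : Measure.map X μ =
      (volume.restrict (Set.Ico (0:ℝ) 1)).withDensity (fun x => ENNReal.ofReal (f x)))
    (hlawY : Measure.map Y μ = volume.restrict (Set.Ico (0:ℝ) 1))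
    (hf0 : ∀ x, 0 ≤ f x) (hg0 : ∀ x, 0 ≤ x → 0 ≤ g x) (hgx : ∀ x, 0 ≤ x → g x ≤ x)
    {C : ℝ} (hC : ∀ x ∈ Set.Icc (0:ℝ) 1, f x ≤ C) :
    μ {ω | g (X ω) ≤ Y ω ∧ Y ω < X ω} =
      ENNReal.ofReal (∫ x in (0:ℝ)..1, f x * (x - g x)) := by
  set E : Set (ℝ × ℝ) := {p | g p.1 ≤ p.2 ∧ p.2 < p.1}
  have hE : MeasurableSet E :=
    (measurableSet_le (hg.comp measurable_fst) measurable_snd).inter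
      (measurableSet_lt measurable_snd measurable_fst)
  have hlaw : μ {ω | g (X ω) ≤ Y ω ∧ Y ω < X ω} =
      ((Measure.map X μ).prod (Measure.map Y μ)) E := by
    rw [← (indepFun_iff_map_prod_eq_prod_map_map hX.aemeasurable hY.aemeasurable).mp hindep,
      Measure.map_apply (hX.prodMk hY) hE]
    rfl
  have : IsProbabilityMeasure (Measure.map Y μ) := Measure.isProbabilityMeasure_map hY.aemeasurable
  rw [hlaw, Measure.prod_apply hE, hlawX,
    lintegral_withDensity_eq_lintegral_mul _ hf.ennreal_ofReal (measurable_measure_prodMk_left hE)]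
  have hsec : ∀ x ∈ Set.Ico (0:ℝ) 1,
      ((fun x => ENNReal.ofReal (f x)) * fun x => Measure.map Y μ (Prod.mk x ⁻¹' E)) x =
        ENNReal.ofReal (f x * (x - g x)) := by
    intro x hx
    have hset : Prod.mk x ⁻¹' E = Set.Ico (g x) x := rfl
    rw [Pi.mul_apply, hset, hlawY, Measure.restrict_apply measurableSet_Ico,
      Set.inter_eq_left.mpr (Set.Ico_subset_Ico (hg0 x hx.1) hx.2.le), Real.volume_Ico,
      ENNReal.ofReal_mul (hf0 x)]
  rw [setLIntegral_congr_fun measurableSet_Ico hsec,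
    intervalIntegral.integral_of_le zero_le_one, ← integral_Ico_eq_integral_Ioc,
    ofReal_integral_eq_lintegral_ofReal]
  · refine Measure.integrableOn_of_bounded (M := C) (by simp) (by fun_prop) ?_
    filter_upwards [ae_restrict_mem measurableSet_Ico] with x hx
    have h1 := hf0 x
    have h2 := hg0 x hx.1
    have h3 := hgx x hx.1
    have h4 := hC x ⟨hx.1, hx.2.le⟩
    rw [Real.norm_eq_abs, abs_of_nonneg (mul_nonneg h1 (by linarith))]
    nlinarith [hx.2]
  · filter_upwards [ae_restrict_mem measurableSet_Ico] with x hx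
    exact mul_nonneg (hf0 x) (sub_nonneg.mpr (hgx x hx.1))

/-- Closed form of the correction probability: with X exponential (rate β ≠ 0) on
[0,1), Y independent uniform on [0,1), and X_b = h⌊X/h⌋, Y_b = h⌊Y/h⌋ for h = 2^{-b},
P(Y_b = X_b | Y < X) = ((e^{βh}(βh − 1) + 1)(1 − e^β))/((1 − e^{βh})(e^β(β − 1) + 1)). -/
theorem correction_probability_closed_form
    {Ω : Type*} [MeasurableSpace Ω] (μ : Measure Ω) [IsProbabilityMeasure μ]
    (b : ℕ) (hb : 0 < b) (h : ℝ) (hh : h = 1 / 2 ^ b) (β : ℝ) (hβ : β ≠ 0)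
    (X Y : Ω → ℝ) (hX : Measurable X) (hY : Measurable Y)
    (hindep : IndepFun X Y μ)
    (hlawX : Measure.map X μ =
      (volume.restrict (Set.Ico (0:ℝ) 1)).withDensity
        (fun x => ENNReal.ofReal (Real.exp (β * x) / ∫ y in (0:ℝ)..1, Real.exp (β * y))))
    (hlawY : Measure.map Y μ = volume.restrict (Set.Ico (0:ℝ) 1))
    (Xb Yb : Ω → ℝ)
    (hXb : ∀ ω, Xb ω = h * (⌊X ω / h⌋ : ℝ)) (hYb : ∀ ω, Yb ω = h * (⌊Y ω / h⌋ : ℝ)) :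
    μ[|{ω | Y ω < X ω}] {ω | Yb ω = Xb ω} =
      ENNReal.ofReal ((Real.exp (β * h) * (β * h - 1) + 1) * (1 - Real.exp β) /
        ((1 - Real.exp (β * h)) * (Real.exp β * (β - 1) + 1))) := by
  have h0 : 0 < h := by rw [hh]; positivity
  have hn : ((2 ^ b : ℕ) : ℝ) * h = 1 := by rw [hh]; push_cast; field_simp
  set c := ∫ y in (0:ℝ)..1, Real.exp (β * y)
  have hc : 0 < c := intervalIntegral.intervalIntegral_pos_of_pos
    (Continuous.intervalIntegrable (by fun_prop) _ _) (fun _ => Real.exp_pos _) one_pos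
  have hf : Measurable fun x => Real.exp (β * x) / c := by fun_prop
  have hf0 (x : ℝ) : 0 ≤ Real.exp (β * x) / c := by positivity
  have hC : ∀ x ∈ Set.Icc (0:ℝ) 1, Real.exp (β * x) / c ≤ Real.exp |β| / c := by
    intro x hx
    gcongr
    nlinarith [le_abs_self β, abs_nonneg β, hx.1, hx.2]
  have hg : Measurable fun x : ℝ => h * (⌊x / h⌋ : ℝ) := by fun_prop
  have hgx (x : ℝ) : h * (⌊x / h⌋ : ℝ) ≤ x := by
    rw [← le_div_iff₀' h0]; exact Int.floor_le _
  have hg0 (x : ℝ) (hx : 0 ≤ x) : 0 ≤ h * (⌊x / h⌋ : ℝ) :=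
    mul_nonneg h0.le (by exact_mod_cast Int.floor_nonneg.mpr (div_nonneg hx h0.le))
  have hcell (x y : ℝ) : y < x ∧ h * (⌊y / h⌋ : ℝ) = h * (⌊x / h⌋ : ℝ) ↔
      h * (⌊x / h⌋ : ℝ) ≤ y ∧ y < x := by
    constructor
    · rintro ⟨h1, h2⟩
      exact ⟨h2 ▸ hgx y, h1⟩
    · rintro ⟨h1, h2⟩
      refine ⟨h2, ?_⟩
      have h3 : ⌊y / h⌋ ≤ ⌊x / h⌋ := Int.floor_le_floor (by gcongr)
      have h4 : ⌊x / h⌋ ≤ ⌊y / h⌋ := Int.le_floor.mpr ((le_div_iff₀' h0).mpr h1)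
      rw [le_antisymm h3 h4]
  have hnum := measure_mem_Ico_of_indepFun hX hY hindep hf hg hlawX hlawY hf0 hg0
    (fun x _ => hgx x) hC
  have hden := measure_mem_Ico_of_indepFun hX hY hindep hf (measurable_const (a := (0:ℝ)))
    hlawX hlawY hf0 (fun _ _ => le_rfl) (fun _ hx => hx) hC
  have hYnonneg : ∀ᵐ ω ∂μ, 0 ≤ Y ω := by
    apply ae_of_ae_map hY.aemeasurable (p := fun y => 0 ≤ y)
    rw [hlawY]
    filter_upwards [ae_restrict_mem measurableSet_Ico] with y hy using hy.1
  have hden' : μ {ω | Y ω < X ω} = μ {ω | 0 ≤ Y ω ∧ Y ω < X ω} := by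
    apply measure_congr
    filter_upwards [hYnonneg] with ω hω
    exact propext ⟨fun hlt => ⟨hω, hlt⟩, fun hlt => hlt.2⟩
  have hinter : {ω | Y ω < X ω} ∩ {ω | Yb ω = Xb ω} =
      {ω | h * (⌊X ω / h⌋ : ℝ) ≤ Y ω ∧ Y ω < X ω} := by
    ext ω
    simp only [Set.mem_inter_iff, Set.mem_ofPred_eq, hXb, hYb]
    exact hcell _ _
  have hpos := exp_mul_sub_one_add_one_pos hβ
  have hIden : ∫ x in (0:ℝ)..1, Real.exp (β * x) / c * (x - 0) =
      (Real.exp β * (β - 1) + 1) / β ^ 2 / c := by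
    simp only [div_mul_eq_mul_div]
    rw [intervalIntegral.integral_div, integral_sub_mul_exp hβ]
    simp only [mul_one, mul_zero, Real.exp_zero]
    field_simp
    ring
  have hq : Real.exp (β * h) ≠ 1 := by
    simp [hβ, h0.ne']
  have hInum : ∫ x in (0:ℝ)..1, Real.exp (β * x) / c * (x - h * (⌊x / h⌋ : ℝ)) =
      (Real.exp β - 1) / (Real.exp (β * h) - 1) *
        ((Real.exp (β * h) * (β * h - 1) + 1) / β ^ 2) / c := by
    have hpow : Real.exp (β * h) ^ (2 ^ b) = Real.exp β := by
      rw [← Real.exp_nat_mul, mul_left_comm, hn, mul_one]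
    have hI := integral_exp_mul_sub_floor hβ h0 (2 ^ b)
    rw [hn, geom_sum_eq hq, hpow] at hI
    simp only [div_mul_eq_mul_div _ c]
    rw [intervalIntegral.integral_div, hI]
  rw [cond_apply (measurableSet_lt hY hX), hinter, hden', hnum, hden, hIden, hInum,
    ← ENNReal.ofReal_inv_of_pos (by positivity), ← ENNReal.ofReal_mul (by positivity)]
  congr 1
  have hq1 : Real.exp (β * h) - 1 ≠ 0 := sub_ne_zero.mpr hq
  have hq2 : 1 - Real.exp (β * h) ≠ 0 := sub_ne_zero.mpr hq.symm
  have hpos' := hpos.ne'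
  generalize Real.exp β * (β - 1) + 1 = D at *
  generalize Real.exp (β * h) * (β * h - 1) + 1 = N at *
  field_simp
  ring
end

section
/- For every natural number α, all real numbers β, r and every h > 0, the binomial expansion identity ∫_r^{r+h} (x − r)·x^{α}·e^{βx} dx = ∑_{j=0}^{α} (α choose j) · r^{j} · e^{βr} · ∫_0^h u^{α+1−j}·e^{βu} du holds. Consequently the correction term arising when bit blasting the generalized-gamma density proportional to x^{α}e^{βx} is a nonnegative combination, with coefficients independent of the grid point r, of the families r ↦ r^{j}e^{βr}. -/
open Real Finset intervalIntegral

/-- Binomial expansion identity: for every natural α, all real β, r and every h > 0,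
∫_r^{r+h} (x − r)·x^α·e^{βx} dx
  = ∑_{j=0}^{α} C(α,j) · r^j · e^{βr} · ∫_0^h u^{α+1−j}·e^{βu} du. -/
theorem binomial_expansion_correction (α : ℕ) (β r h : ℝ) (hh : 0 < h) :
    (∫ x in r..(r + h), (x - r) * x ^ α * Real.exp (β * x)) =
      ∑ j ∈ Finset.range (α + 1),
        (α.choose j : ℝ) * r ^ j * Real.exp (β * r) *
          ∫ u in (0:ℝ)..h, u ^ (α + 1 - j) * Real.exp (β * u) := by
  have shift : (∫ u in (0:ℝ)..h, (u + r - r) * (u + r) ^ α * Real.exp (β * (u + r))) =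
      ∫ x in r..(r + h), (x - r) * x ^ α * Real.exp (β * x) := by
    rw [intervalIntegral.integral_comp_add_right
      (fun x => (x - r) * x ^ α * Real.exp (β * x)) r, zero_add, add_comm h r]
  have expand : ∀ u : ℝ, (u + r - r) * (u + r) ^ α * Real.exp (β * (u + r)) =
      ∑ j ∈ Finset.range (α + 1), (α.choose j : ℝ) * r ^ j * Real.exp (β * r) *
        (u ^ (α + 1 - j) * Real.exp (β * u)) := by
    intro u
    rw [add_sub_cancel_right, add_comm u r, add_pow, mul_add, Real.exp_add, Finset.mul_sum,
      Finset.sum_mul]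
    refine Finset.sum_congr rfl fun j hj => ?_
    rw [Nat.sub_add_comm (Finset.mem_range_succ_iff.mp hj), pow_succ]
    ring
  rw [← shift]
  simp_rw [expand]
  rw [intervalIntegral.integral_finsetSum
    fun j _ => Continuous.intervalIntegrable (by fun_prop) _ _]
  simp_rw [intervalIntegral.integral_const_mul]
end
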